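/- The set of valid sentences of InqBQ and the set of id-valid sentences of InqBQ are not recursively enumerable: under any effective Gödel numbering of InqBQ sentences over a signature containing at least one binary predicate symbol and the two constants a,b, neither {⌜φ⌝ | φ is id-valid} nor {⌜φ⌝ | φ is valid} is recursively enumerable. -/

import Mathlib

namespace InqBQ

/-- A signature: predicate symbols and function symbols, each with an arity. -/
structure Sig where
  Pred : Type
  parity : Pred → ℕ
  Func : Type
  farity : Func → ℕ

/-- Terms over a signature, with variables indexed by `ℕ`. -/
inductive Term (σ : Sig) : Type where
  | var : ℕ → Term σ
  | func : (f : σ.Func) → (Fin (σ.farity f) → Term σ) → Term σ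

/-- Formulas of InqBQ. -/
inductive Formula (σ : Sig) : Type where
  | pred : (P : σ.Pred) → (Fin (σ.parity P) → Term σ) → Formula σ
  | eq : Term σ → Term σ → Formula σ
  | falsum : Formula σ
  | conj : Formula σ → Formula σ → Formula σ
  | idisj : Formula σ → Formula σ → Formula σ
  | impl : Formula σ → Formula σ → Formula σ
  | all : ℕ → Formula σ → Formula σ
  | iex : ℕ → Formula σ → Formula σ

variable {σ : Sig}

/-- ¬φ := φ → ⊥ -/
def Formula.neg (φ : Formula σ) : Formula σ := .impl φ .falsum

/-- ?φ := φ ⩒ ¬φ -/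
def Formula.qm (φ : Formula σ) : Formula σ := .idisj φ φ.neg

/-- ⊤ := ¬⊥ -/
def Formula.verum : Formula σ := Formula.neg .falsum

/-- Classical formulas: no inquisitive disjunction, no inquisitive existential. -/
def Formula.IsClassical : Formula σ → Prop
  | .pred _ _ => True
  | .eq _ _ => True
  | .falsum => True
  | .conj φ ψ => φ.IsClassical ∧ ψ.IsClassical
  | .idisj _ _ => False
  | .impl φ ψ => φ.IsClassical ∧ ψ.IsClassical
  | .all _ φ => φ.IsClassical
  | .iex _ _ => False

/-- The variable `n` occurs in a term. -/
def Term.VarOccurs : Term σ → ℕ → Prop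
  | .var m, n => m = n
  | .func _ ts, n => ∃ i, (ts i).VarOccurs n

/-- The variable `n` occurs free in a formula. -/
def Formula.FreeVar : Formula σ → ℕ → Prop
  | .pred _ ts, n => ∃ i, (ts i).VarOccurs n
  | .eq t t', n => t.VarOccurs n ∨ t'.VarOccurs n
  | .falsum, _ => False
  | .conj φ ψ, n => φ.FreeVar n ∨ ψ.FreeVar n
  | .idisj φ ψ, n => φ.FreeVar n ∨ ψ.FreeVar n
  | .impl φ ψ, n => φ.FreeVar n ∨ ψ.FreeVar n
  | .all x φ, n => n ≠ x ∧ φ.FreeVar n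
  | .iex x φ, n => n ≠ x ∧ φ.FreeVar n

/-- A sentence is a formula with no free variables. -/
def Formula.IsSentence (φ : Formula σ) : Prop := ∀ n, ¬ φ.FreeVar n

/-- A first-order information model `M = (W, D, I, ∼)`. -/
structure Model (σ : Sig) where
  W : Type
  D : Type
  wNonempty : Nonempty W
  dNonempty : Nonempty D
  predI : W → (P : σ.Pred) → (Fin (σ.parity P) → D) → Prop
  funcI : W → (f : σ.Func) → (Fin (σ.farity f) → D) → D
  eqI : W → D → D → Prop
  eqEquiv : ∀ w, Equivalence (eqI w)
  predCongr : ∀ w P (as bs : Fin (σ.parity P) → D),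
      (∀ i, eqI w (as i) (bs i)) → (predI w P as ↔ predI w P bs)
  funcCongr : ∀ w f (as bs : Fin (σ.farity f) → D),
      (∀ i, eqI w (as i) (bs i)) → eqI w (funcI w f as) (funcI w f bs)

/-- Denotation `[t]^g_w` of a term at a world under an assignment. -/
def Term.val (M : Model σ) (w : M.W) (g : ℕ → M.D) : Term σ → M.D
  | .var n => g n
  | .func f ts => M.funcI w f (fun i => (ts i).val M w g)

/-- The support relation `M, s ⊨_g φ`. -/
def Support (M : Model σ) : Set M.W → (ℕ → M.D) → Formula σ → Prop
  | s, g, .pred P ts => ∀ w ∈ s, M.predI w P (fun i => (ts i).val M w g)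
  | s, g, .eq t t' => ∀ w ∈ s, M.eqI w (t.val M w g) (t'.val M w g)
  | s, _, .falsum => s = ∅
  | s, g, .conj φ ψ => Support M s g φ ∧ Support M s g ψ
  | s, g, .idisj φ ψ => Support M s g φ ∨ Support M s g ψ
  | s, g, .impl φ ψ => ∀ t : Set M.W, t ⊆ s → Support M t g φ → Support M t g ψ
  | s, g, .all x φ => ∀ d : M.D, Support M s (Function.update g x d) φ
  | s, g, .iex x φ => ∃ d : M.D, Support M s (Function.update g x d) φ

/-- Id-models: `=` is interpreted as identity on the domain at each world. -/
def Model.IsId (M : Model σ) : Prop := ∀ w (d d' : M.D), M.eqI w d d' ↔ d = d'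

/-- Entailment in InqBQ. -/
def Entails (Φ : Set (Formula σ)) (ψ : Formula σ) : Prop :=
  ∀ (M : Model σ) (s : Set M.W) (g : ℕ → M.D),
    (∀ φ ∈ Φ, Support M s g φ) → Support M s g ψ

/-- Entailment restricted to id-models. -/
def EntailsId (Φ : Set (Formula σ)) (ψ : Formula σ) : Prop :=
  ∀ (M : Model σ), M.IsId → ∀ (s : Set M.W) (g : ℕ → M.D),
    (∀ φ ∈ Φ, Support M s g φ) → Support M s g ψ

/-- Validity in InqBQ. -/
def Valid (ψ : Formula σ) : Prop :=
  ∀ (M : Model σ) (s : Set M.W) (g : ℕ → M.D), Support M s g ψ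

/-- Validity over id-models. -/
def IdValid (ψ : Formula σ) : Prop :=
  ∀ (M : Model σ), M.IsId → ∀ (s : Set M.W) (g : ℕ → M.D), Support M s g ψ

/-- Equivalence of formulas. -/
def FmEquiv (φ ψ : Formula σ) : Prop :=
  ∀ (M : Model σ) (s : Set M.W) (g : ℕ → M.D), Support M s g φ ↔ Support M s g ψ

/-- A formula is truth-conditional if support at a state reduces to truth at each world. -/
def TruthConditional (φ : Formula σ) : Prop :=
  ∀ (M : Model σ) (s : Set M.W) (g : ℕ → M.D),
    Support M s g φ ↔ ∀ w ∈ s, Support M {w} g φ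

/-- A standard (Tarskian) relational structure for the signature. -/
structure Struc (σ : Sig) where
  D : Type
  dNonempty : Nonempty D
  predI : (P : σ.Pred) → (Fin (σ.parity P) → D) → Prop
  funcI : (f : σ.Func) → (Fin (σ.farity f) → D) → D

/-- Tarskian term denotation. -/
def Term.tval (A : Struc σ) (g : ℕ → A.D) : Term σ → A.D
  | .var n => g n
  | .func f ts => A.funcI f (fun i => (ts i).tval A g)

/-- Standard Tarskian satisfaction (reading `→` as material implication, `=` as identity). -/
def TSat (A : Struc σ) : (ℕ → A.D) → Formula σ → Prop
  | g, .pred P ts => A.predI P (fun i => (ts i).tval A g)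
  | g, .eq t t' => t.tval A g = t'.tval A g
  | _, .falsum => False
  | g, .conj φ ψ => TSat A g φ ∧ TSat A g ψ
  | g, .idisj φ ψ => TSat A g φ ∨ TSat A g ψ
  | g, .impl φ ψ => TSat A g φ → TSat A g ψ
  | g, .all x φ => ∀ d : A.D, TSat A (Function.update g x d) φ
  | g, .iex x φ => ∃ d : A.D, TSat A (Function.update g x d) φ

/-- Classical first-order (Tarskian) entailment. -/
def FOLEntails (Γ : Set (Formula σ)) (α : Formula σ) : Prop :=
  ∀ (A : Struc σ) (g : ℕ → A.D), (∀ γ ∈ Γ, TSat A g γ) → TSat A g α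

/-- The setoid on the domain given by `∼_w`. -/
def Model.setoidAt (M : Model σ) (w : M.W) : Setoid M.D := ⟨M.eqI w, M.eqEquiv w⟩

/-- The quotient relational structure `𝓜_w = (D/∼_w, I_w^∼)` induced at world `w`. -/
noncomputable def Model.quotStruc (M : Model σ) (w : M.W) : Struc σ where
  D := Quotient (M.setoidAt w)
  dNonempty := Nonempty.map (Quotient.mk (M.setoidAt w)) M.dNonempty
  predI P as := ∃ bs : Fin (σ.parity P) → M.D,
    (∀ i, Quotient.mk (M.setoidAt w) (bs i) = as i) ∧ M.predI w P bs
  funcI f as := Quotient.mk (M.setoidAt w) (M.funcI w f (fun i => (as i).out))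

/-- λt := ∃̷x (x = t). -/
def lam (x : ℕ) (t : Term σ) : Formula σ := .iex x (.eq (.var x) t)

/-- Conjunction of a finite list of formulas. -/
def conjList (l : List (Formula σ)) : Formula σ := l.foldr .conj Formula.verum

/-- x ≠ t. -/
def neTm (x : ℕ) (t : Term σ) : Formula σ := (Formula.eq (.var x) t).neg

/-- ∃̷x (x ≠ t). -/
def iexNe (t : Term σ) : Formula σ := .iex 0 (neTm 0 t)

/-- η := (=(a;b) ∧ =(b;a) ∧ ∃̷x(x≠b)) → ∃̷x(x≠a). -/
def etaOf (a b : Term σ) : Formula σ :=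
  .impl (.conj (.impl (lam 0 a) (lam 0 b))
          (.conj (.impl (lam 0 b) (lam 0 a)) (iexNe b)))
    (iexNe a)

/-- θ := ∃̷x ∃̷y ¬(x = a ∧ y = b). -/
def thetaOf (a b : Term σ) : Formula σ :=
  .iex 0 (.iex 1 (Formula.neg (.conj (.eq (.var 0) a) (.eq (.var 1) b))))

/-- ρ := ∀x∀y ?(x = y). -/
def rho : Formula σ := .all 0 (.all 1 (Formula.qm (.eq (.var 0) (.var 1))))

/-- The signature with exactly two constant symbols `a`, `b` (and no predicates). -/
def sigAB : Sig where
  Pred := Empty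
  parity := fun P => P.elim
  Func := Bool
  farity := fun _ => 0

/-- The constant `a`. -/
def tA : Term sigAB := .func false Fin.elim0

/-- The constant `b`. -/
def tB : Term sigAB := .func true Fin.elim0

def etaAB : Formula sigAB := etaOf tA tB

def thetaAB : Formula sigAB := thetaOf tA tB

/-- `a_w`. -/
def aVal (M : Model sigAB) (w : M.W) : M.D := M.funcI w false Fin.elim0

/-- `b_w`. -/
def bVal (M : Model sigAB) (w : M.W) : M.D := M.funcI w true Fin.elim0

/-- `R_s = {(a_w, b_w) | w ∈ s}`. -/
def RelOf (M : Model sigAB) (s : Set M.W) : Set (M.D × M.D) :=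
  {p | ∃ w ∈ s, p = (aVal M w, bVal M w)}

/-- An id-model (for the signature with the two constants a, b) is full if `R_W = D × D`. -/
def Model.IsFull (M : Model sigAB) : Prop := RelOf M Set.univ = Set.univ

/-- Classical existential quantifier ∃xφ := ¬∀x¬φ. -/
def cExists (x : ℕ) (φ : Formula σ) : Formula σ := (Formula.all x φ.neg).neg

/-- ⋀_{i<j<n} (xᵢ ≠ xⱼ). -/
def distinctFm (n : ℕ) : Formula sigAB :=
  conjList ((List.range n).flatMap fun i => (List.range n).filterMap fun j =>
    if i < j then some ((Formula.eq (.var i) (.var j)).neg) else none)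

/-- χₙ := ∃x₁…∃xₙ ⋀_{i<j} (xᵢ ≠ xⱼ), expressing that there are at least n elements. -/
def chi (n : ℕ) : Formula sigAB := (List.range n).foldr cExists (distinctFm n)

/-- The canonical full id-model over a nonempty domain `D`: worlds are pairs `(d, e)`,
with `a_{(d,e)} = d` and `b_{(d,e)} = e`. -/
def canonModel (D : Type) (hD : Nonempty D) : Model sigAB where
  W := D × D
  D := D
  wNonempty := Nonempty.map (fun d => (d, d)) hD
  dNonempty := hD
  predI := fun _ P => P.elim
  funcI := fun w f _ => cond f w.2 w.1
  eqI := fun _ => Eq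
  eqEquiv := fun _ => eq_equivalence
  predCongr := fun _ P => P.elim
  funcCongr := fun _ _ _ _ _ => rfl

/-- Extending a signature with two fresh constant symbols `a`, `b`. -/
def sigExt (σ : Sig) : Sig where
  Pred := σ.Pred
  parity := σ.parity
  Func := σ.Func ⊕ Bool
  farity := Sum.elim σ.farity (fun _ => 0)

/-- Lift of a term to the extended signature. -/
def Term.lift : Term σ → Term (sigExt σ)
  | .var n => .var n
  | .func f ts => .func (Sum.inl f) (fun i => (ts i).lift)

/-- Lift of a formula to the extended signature. -/
def Formula.lift : Formula σ → Formula (sigExt σ)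
  | .pred P ts => .pred P (fun i => (ts i).lift)
  | .eq t t' => .eq t.lift t'.lift
  | .falsum => .falsum
  | .conj φ ψ => .conj φ.lift ψ.lift
  | .idisj φ ψ => .idisj φ.lift ψ.lift
  | .impl φ ψ => .impl φ.lift ψ.lift
  | .all x φ => .all x φ.lift
  | .iex x φ => .iex x φ.lift

/-- The fresh constant `a` of the extended signature. -/
def extA : Term (sigExt σ) := .func (Sum.inr false) Fin.elim0

/-- The fresh constant `b` of the extended signature. -/
def extB : Term (sigExt σ) := .func (Sum.inr true) Fin.elim0

/-- The canonical full id-model based on a relational structure `𝓜`: worlds are pairs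
`(d, e)`; `a_{(d,e)} = d`, `b_{(d,e)} = e`, and all symbols of `σ` are interpreted
rigidly as in `𝓜`. -/
def canonModelOf (A : Struc σ) : Model (sigExt σ) where
  W := A.D × A.D
  D := A.D
  wNonempty := Nonempty.map (fun d => (d, d)) A.dNonempty
  dNonempty := A.dNonempty
  predI := fun _ P => A.predI P
  funcI := fun w f => match f with
    | .inl f₀ => fun as => A.funcI f₀ as
    | .inr b => fun _ => cond b w.2 w.1
  eqI := fun _ => Eq
  eqEquiv := fun _ => eq_equivalence
  predCongr := fun _ P as bs h => by
    have hab : as = bs := funext fun i => h i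
    rw [hab]
  funcCongr := fun w f as bs h => by
    have hab : as = bs := funext fun i => h i
    rw [hab]

/-- The signature with one binary predicate symbol and the two constants a, b. -/
def sig19 : Sig where
  Pred := Unit
  parity := fun _ => 2
  Func := Bool
  farity := fun _ => 0

/-- The standard (structural) Gödel numbering of terms of `sig19`. -/
def termCode : Term sig19 → ℕ
  | .var n => Nat.pair 0 n
  | .func b _ => Nat.pair 1 (cond b 1 0)

/-- The standard (structural) Gödel numbering of formulas of `sig19`. -/
def fmlCode : Formula sig19 → ℕ
  | .pred _ ts => Nat.pair 0 (Nat.pair (termCode (ts ⟨0, Nat.zero_lt_two⟩)) (termCode (ts ⟨1, Nat.one_lt_two⟩)))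
  | .eq t t' => Nat.pair 1 (Nat.pair (termCode t) (termCode t'))
  | .falsum => Nat.pair 2 0
  | .conj φ ψ => Nat.pair 3 (Nat.pair (fmlCode φ) (fmlCode ψ))
  | .idisj φ ψ => Nat.pair 4 (Nat.pair (fmlCode φ) (fmlCode ψ))
  | .impl φ ψ => Nat.pair 5 (Nat.pair (fmlCode φ) (fmlCode ψ))
  | .all x φ => Nat.pair 6 (Nat.pair x (fmlCode φ))
  | .iex x φ => Nat.pair 7 (Nat.pair x (fmlCode φ))

/-- A set of natural numbers is recursively enumerable iff it is the domain of a
partial computable function. -/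
def REset (S : Set ℕ) : Prop :=
  ∃ f : ℕ →. ℕ, Nat.Partrec f ∧ ∀ n, n ∈ S ↔ (f n).Dom

/-- An effective Gödel numbering of the formulas of `sig19`: an injective numbering
that is computably intertranslatable with the standard structural numbering. -/
structure EffectiveNumbering : Type where
  nu : Formula sig19 → ℕ
  inj : Function.Injective nu
  toStd : ∃ F : ℕ →. ℕ, Nat.Partrec F ∧
    ∀ φ : Formula sig19, F (nu φ) = Part.some (fmlCode φ)
  ofStd : ∃ G : ℕ →. ℕ, Nat.Partrec G ∧
    ∀ φ : Formula sig19, G (fmlCode φ) = Part.some (nu φ)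

/-! ### Formulas used in the reduction -/

def cA : Term sig19 := .func false Fin.elim0

def cB : Term sig19 := .func true Fin.elim0

def eqF (x y : ℕ) : Formula sig19 := .eq (.var x) (.var y)

def atomR (u v : ℕ) : Formula sig19 :=
  .pred () (fun i => if i.1 = 0 then .var u else .var v)

/-- Positive literal of the simulated 4-ary predicate. -/
def qp (x y u v : ℕ) : Formula sig19 :=
  .impl (.conj (.eq (.var x) cA) (.eq (.var y) cB)) (atomR u v)

/-- Negative literal of the simulated 4-ary predicate. -/
def qn (x y u v : ℕ) : Formula sig19 :=
  .impl (.conj (.eq (.var x) cA) (.eq (.var y) cB)) (atomR u v).neg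

def atR (M : Model sig19) (w : M.W) (d e : M.D) : Prop :=
  M.predI w () (fun i => if i.1 = 0 then d else e)

def atA (M : Model sig19) (w : M.W) : M.D := M.funcI w false Fin.elim0

def atB (M : Model sig19) (w : M.W) : M.D := M.funcI w true Fin.elim0

def QP (M : Model sig19) (s : Set M.W) (x y u v : M.D) : Prop :=
  ∀ w ∈ s, M.eqI w x (atA M w) → M.eqI w y (atB M w) → atR M w u v

def QN (M : Model sig19) (s : Set M.W) (x y u v : M.D) : Prop :=
  ∀ w ∈ s, M.eqI w x (atA M w) → M.eqI w y (atB M w) → ¬ atR M w u v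

def QE (M : Model sig19) (s : Set M.W) (x y : M.D) : Prop :=
  ∀ w ∈ s, M.eqI w x y

section supp

variable (M : Model sig19) (s : Set M.W) (g : ℕ → M.D)

lemma val_cA (w : M.W) : cA.val M w g = atA M w := by
  simp only [cA, Term.val, atA]
  congr 1
  funext i
  exact i.elim0

lemma val_cB (w : M.W) : cB.val M w g = atB M w := by
  simp only [cB, Term.val, atB]
  congr 1
  funext i
  exact i.elim0

lemma supp_eqF (x y : ℕ) : Support M s g (eqF x y) ↔ QE M s (g x) (g y) := Iff.rfl

lemma supp_atomR (u v : ℕ) :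
    Support M s g (atomR u v) ↔ ∀ w ∈ s, atR M w (g u) (g v) := by
  simp only [atomR, Support, atR]
  refine forall₂_congr fun w _ => ?_
  have : (fun i : Fin (sig19.parity ()) =>
      (if i.1 = 0 then (Term.var u : Term sig19) else Term.var v).val M w g)
      = (fun i => if i.1 = 0 then g u else g v) := by
    funext i
    split_ifs <;> rfl
  rw [this]

lemma supp_qp (x y u v : ℕ) :
    Support M s g (qp x y u v) ↔ QP M s (g x) (g y) (g u) (g v) := by
  rw [qp, Support]
  simp only [Support, supp_atomR, val_cA, val_cB, Term.val]
  constructor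
  · intro h w hw h1 h2
    refine h {w} (by simpa using hw) ⟨?_, ?_⟩ w rfl
    · rintro w' rfl; exact h1
    · rintro w' rfl; exact h2
  · intro h t ht h1 w hw
    exact h w (ht hw) (h1.1 w hw) (h1.2 w hw)

lemma supp_qn (x y u v : ℕ) :
    Support M s g (qn x y u v) ↔ QN M s (g x) (g y) (g u) (g v) := by
  rw [qn, Formula.neg, Support]
  simp only [Support, supp_atomR, val_cA, val_cB, Term.val]
  constructor
  · intro h w hw h1 h2 h3
    have := h {w} (by simpa using hw) ⟨?_, ?_⟩ {w} subset_rfl (by rintro w' rfl; exact h3)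
    · simp at this
    · rintro w' rfl; exact h1
    · rintro w' rfl; exact h2
  · intro h t ht h1 t' ht' h2
    by_contra hne
    obtain ⟨w, hw⟩ := Set.nonempty_iff_ne_empty.mpr hne
    exact h w (ht (ht' hw)) (h1.1 w (ht' hw)) (h1.2 w (ht' hw)) (h2 w hw)

end supp

/-! Abbreviations: variables `0..6` denote the first numerals and also tags. -/

def ltF (x y : ℕ) : Formula sig19 := qp 0 x y y
def ltN (x y : ℕ) : Formula sig19 := qn 0 x y y
def scF (x y : ℕ) : Formula sig19 := qp 1 x y y
def scN (x y : ℕ) : Formula sig19 := qn 1 x y y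
def prF (x y z : ℕ) : Formula sig19 := qp 2 x y z
def prN (x y z : ℕ) : Formula sig19 := qn 2 x y z
def evF (x y z : ℕ) : Formula sig19 := qp 3 x y z
def evN (x y z : ℕ) : Formula sig19 := qn 3 x y z

local infixr:60 "⊓⊓" => Formula.conj
local infixr:55 "⊔⊔" => Formula.idisj

def axIrr : Formula sig19 := .all 10 (ltN 10 10)

def axTrans : Formula sig19 := .all 10 (.all 11 (.all 12 (ltN 10 11 ⊔⊔ ltN 11 12 ⊔⊔ ltF 10 12)))

def axZero : Formula sig19 := .all 10 (ltN 10 0)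

def axSucc : Formula sig19 := .all 10 (.all 11 (scN 10 11 ⊔⊔
  (ltF 10 11 ⊓⊓ .all 12 (ltN 12 11 ⊔⊔ ltF 12 10 ⊔⊔ eqF 12 10))))

def axChain : Formula sig19 :=
  scF 0 1 ⊓⊓ scF 1 2 ⊓⊓ scF 2 3 ⊓⊓ scF 3 4 ⊓⊓ scF 4 5 ⊓⊓ scF 5 6

def axPair : Formula sig19 := .all 10 (.all 11 (.all 12 (prN 10 11 12 ⊔⊔
  (eqF 10 0 ⊓⊓ eqF 11 0 ⊓⊓ eqF 12 0) ⊔⊔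
  .iex 13 (.iex 14 (.iex 15 (scF 15 12 ⊓⊓ prF 13 14 15 ⊓⊓
    ((ltF 13 14 ⊓⊓ scF 13 10 ⊓⊓ ltF 10 14 ⊓⊓ eqF 11 14) ⊔⊔
     (scF 13 14 ⊓⊓ eqF 10 14 ⊓⊓ eqF 11 0) ⊔⊔
     (ltF 14 13 ⊓⊓ eqF 10 13 ⊓⊓ scF 14 11) ⊔⊔
     (eqF 14 13 ⊓⊓ eqF 10 0 ⊓⊓ scF 13 11))))))))

/-- 10 = code, 11 = input, 12 = output. -/
def axEval : Formula sig19 := .all 10 (.all 11 (.all 12 (evN 10 11 12 ⊔⊔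
  .iex 13 (.iex 14 (prF 13 14 10 ⊓⊓
    ((eqF 13 0 ⊓⊓ eqF 12 0) ⊔⊔
     (eqF 13 1 ⊓⊓ scF 11 12) ⊔⊔
     (eqF 13 2 ⊓⊓ .iex 15 (prF 12 15 11)) ⊔⊔
     (eqF 13 3 ⊓⊓ .iex 15 (prF 15 12 11)) ⊔⊔
     .iex 15 (.iex 16 (prF 15 16 14 ⊓⊓
       ((eqF 13 4 ⊓⊓ .iex 17 (.iex 18 (evF 15 11 17 ⊓⊓ evF 16 11 18 ⊓⊓ prF 17 18 12))) ⊔⊔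
        (eqF 13 5 ⊓⊓ .iex 17 (evF 16 11 17 ⊓⊓ evF 15 17 12)) ⊔⊔
        (eqF 13 6 ⊓⊓ .iex 17 (.iex 18 (prF 17 18 11 ⊓⊓
          ((eqF 18 0 ⊓⊓ evF 15 17 12) ⊔⊔
           .iex 19 (.iex 20 (.iex 21 (.iex 22 (.iex 23 (
             scF 19 18 ⊓⊓ prF 17 19 20 ⊓⊓ evF 10 20 21 ⊓⊓ prF 19 21 22 ⊓⊓
             prF 17 22 23 ⊓⊓ evF 16 23 12))))))))))))))))))

/-- `7` is the numeral `n`. -/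
def numF : ℕ → Formula sig19
  | 0 => eqF 7 0
  | n + 1 => .iex 8 (scF 8 7 ⊓⊓ .iex 7 (eqF 7 8 ⊓⊓ numF n))

/-- program number `c` on `(n,k)` outputs `0`, for some `k` -/
def goalF (c n : ℕ) : Formula sig19 :=
  .iex 9 (.iex 10 (.iex 11 (.iex 12 (prF 10 11 12 ⊓⊓ evF 9 12 0 ⊓⊓
    .iex 7 (eqF 7 9 ⊓⊓ numF c) ⊓⊓ .iex 7 (eqF 7 10 ⊓⊓ numF n)))))

def axs : Formula sig19 :=
  axIrr ⊓⊓ axTrans ⊓⊓ axZero ⊓⊓ axSucc ⊓⊓ axChain ⊓⊓ axPair ⊓⊓ axEval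

def AxF (c n : ℕ) : Formula sig19 :=
  .iex 0 (.iex 1 (.iex 2 (.iex 3 (.iex 4 (.iex 5 (.iex 6 (axs ⊓⊓ goalF c n)))))))

/-- The sentence of the reduction. -/
def phi (c n : ℕ) : Formula sig19 :=
  .impl (rho ⊓⊓ etaOf cA cB ⊓⊓ AxF c n) (thetaOf cA cB)

/-! ### The semantic content of the axioms -/

section sem

variable {D : Type} (P N : D → D → D → D → Prop) (Q : D → D → Prop)

def JPair (k : ℕ → D) (x y z : D) : Prop :=
  (Q x (k 0) ∧ Q y (k 0) ∧ Q z (k 0)) ∨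
  ∃ x' y' z', P (k 1) z' z z ∧ P (k 2) x' y' z' ∧
    ((P (k 0) x' y' y' ∧ P (k 1) x' x x ∧ P (k 0) x y' y' ∧ Q y y') ∨
     (P (k 1) x' y' y' ∧ Q x y' ∧ Q y (k 0)) ∨
     (P (k 0) y' x' x' ∧ Q x x' ∧ P (k 1) y' y y) ∨
     (Q y' x' ∧ Q x (k 0) ∧ P (k 1) x' y y))

def JEval (k : ℕ → D) (c x y : D) : Prop :=
  ∃ h r, P (k 2) h r c ∧
    ((Q h (k 0) ∧ Q y (k 0)) ∨
     (Q h (k 1) ∧ P (k 1) x y y) ∨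
     (Q h (k 2) ∧ ∃ v, P (k 2) y v x) ∨
     (Q h (k 3) ∧ ∃ v, P (k 2) v y x) ∨
     ∃ f g, P (k 2) f g r ∧
      ((Q h (k 4) ∧ ∃ u v, P (k 3) f x u ∧ P (k 3) g x v ∧ P (k 2) u v y) ∨
       (Q h (k 5) ∧ ∃ u, P (k 3) g x u ∧ P (k 3) f u y) ∨
       (Q h (k 6) ∧ ∃ a n, P (k 2) a n x ∧
        ((Q n (k 0) ∧ P (k 3) f a y) ∨
         ∃ m q i p p', P (k 1) m n n ∧ P (k 2) a m q ∧ P (k 3) c q i ∧ P (k 2) m i p ∧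
           P (k 2) a p p' ∧ P (k 3) g p' y))))

structure AxS (k : ℕ → D) : Prop where
  irr : ∀ x, N (k 0) x x x
  trans : ∀ x y z, N (k 0) x y y ∨ N (k 0) y z z ∨ P (k 0) x z z
  zero : ∀ x, N (k 0) x (k 0) (k 0)
  succ : ∀ x y, N (k 1) x y y ∨
    (P (k 0) x y y ∧ ∀ z, N (k 0) z y y ∨ P (k 0) z x x ∨ Q z x)
  chain : P (k 1) (k 0) (k 1) (k 1) ∧ P (k 1) (k 1) (k 2) (k 2) ∧ P (k 1) (k 2) (k 3) (k 3) ∧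
    P (k 1) (k 3) (k 4) (k 4) ∧ P (k 1) (k 4) (k 5) (k 5) ∧ P (k 1) (k 5) (k 6) (k 6)
  pair : ∀ x y z, N (k 2) x y z ∨ JPair P Q k x y z
  eval : ∀ c x y, N (k 3) c x y ∨ JEval P Q k c x y

end sem

lemma supp_axs (M : Model sig19) (s : Set M.W) (g : ℕ → M.D) :
    Support M s g axs ↔ AxS (QP M s) (QN M s) (QE M s) g := by
  simp only [axs, axIrr, axTrans, axZero, axSucc, axChain, axPair, axEval, ltF, ltN, scF, scN,
    prF, prN, evF, evN, Support, supp_qp, supp_qn, supp_eqF]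
  simp
  constructor
  · rintro ⟨h1, h2, h3, h4, h5, h6, h7⟩
    exact ⟨h1, h2, h3, h4, h5, h6, by simpa [JEval] using h7⟩
  · rintro ⟨h1, h2, h3, h4, h5, h6, h7⟩
    exact ⟨h1, h2, h3, h4, h5, h6, by simpa [JEval] using h7⟩

/-! ### Sentencehood -/

lemma occ_cA (m : ℕ) : ¬ cA.VarOccurs m := by
  rintro ⟨i, -⟩
  exact i.elim0

lemma occ_cB (m : ℕ) : ¬ cB.VarOccurs m := by
  rintro ⟨i, -⟩
  exact i.elim0

lemma free_eqF (x y m : ℕ) : (eqF x y).FreeVar m ↔ x = m ∨ y = m := Iff.rfl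

lemma free_atomR (u v m : ℕ) : (atomR u v).FreeVar m ↔ u = m ∨ v = m := by
  constructor
  · rintro ⟨i, hi⟩
    dsimp only at hi
    split_ifs at hi
    · exact Or.inl hi
    · exact Or.inr hi
  · rintro (h | h)
    · exact ⟨⟨0, Nat.zero_lt_two⟩, h⟩
    · exact ⟨⟨1, Nat.one_lt_two⟩, h⟩

lemma free_qp (x y u v m : ℕ) : (qp x y u v).FreeVar m ↔ (x = m ∨ y = m) ∨ u = m ∨ v = m := by
  simp [qp, Formula.FreeVar, free_atomR, occ_cA, occ_cB, Term.VarOccurs]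

lemma free_qn (x y u v m : ℕ) : (qn x y u v).FreeVar m ↔ (x = m ∨ y = m) ∨ u = m ∨ v = m := by
  simp [qn, Formula.neg, Formula.FreeVar, free_atomR, occ_cA, occ_cB, Term.VarOccurs]

lemma numF_free (n m : ℕ) (h : (numF n).FreeVar m) : m = 7 ∨ m = 0 ∨ m = 1 := by
  induction n with
  | zero => simp [numF, free_eqF] at h; omega
  | succ n ih =>
    simp only [numF, free_eqF, scF, free_qp, Formula.FreeVar] at h
    by_cases hn : (numF n).FreeVar m
    · exact ih hn
    · grind

lemma goalF_free (c n m : ℕ) (h : (goalF c n).FreeVar m) : m ≤ 6 := by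
  simp only [goalF, free_eqF, prF, evF, free_qp, Formula.FreeVar] at h
  have h1 := numF_free n m
  have h2 := numF_free c m
  grind

lemma axs_free (m : ℕ) (h : axs.FreeVar m) : m ≤ 6 := by
  by_contra hm
  simp only [axs, axIrr, axTrans, axZero, axSucc, axChain, axPair, axEval, ltF, ltN, scF, scN,
    prF, prN, evF, evN, free_qp, free_qn, free_eqF, Formula.FreeVar] at h
  have e0 : 0 ≠ m := by omega
  have e1 : 1 ≠ m := by omega
  have e2 : 2 ≠ m := by omega
  have e3 : 3 ≠ m := by omega
  have e4 : 4 ≠ m := by omega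
  have e5 : 5 ≠ m := by omega
  have e6 : 6 ≠ m := by omega
  simp only [e0, e1, e2, e3, e4, e5, e6, false_or, or_false] at h
  grind

lemma phi_sentence (c n : ℕ) : (phi c n).IsSentence := by
  intro m h
  have h1 := axs_free m
  have h2 := goalF_free c n m
  simp only [phi, AxF, rho, etaOf, thetaOf, lam, iexNe, neTm, Formula.neg, Formula.qm,
    Formula.FreeVar, occ_cA, occ_cB, Term.VarOccurs] at h
  grind


/-! ### Primitive recursive programs -/

inductive PCode : Type where
  | zero | succ | left | right
  | pair : PCode → PCode → PCode
  | comp : PCode → PCode → PCode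
  | prec : PCode → PCode → PCode

def PCode.run : PCode → ℕ → ℕ
  | .zero, _ => 0
  | .succ, n => n + 1
  | .left, n => n.unpair.1
  | .right, n => n.unpair.2
  | .pair f g, n => Nat.pair (f.run n) (g.run n)
  | .comp f g, n => f.run (g.run n)
  | .prec f g, n => Nat.rec (f.run n.unpair.1)
      (fun y i => g.run (Nat.pair n.unpair.1 (Nat.pair y i))) n.unpair.2

def PCode.enc : PCode → ℕ
  | .zero => Nat.pair 0 0
  | .succ => Nat.pair 1 0
  | .left => Nat.pair 2 0
  | .right => Nat.pair 3 0
  | .pair f g => Nat.pair 4 (Nat.pair f.enc g.enc)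
  | .comp f g => Nat.pair 5 (Nat.pair f.enc g.enc)
  | .prec f g => Nat.pair 6 (Nat.pair f.enc g.enc)

lemma PCode.exists_code {f : ℕ → ℕ} (hf : Nat.Primrec f) : ∃ C : PCode, ∀ n, C.run n = f n := by
  induction hf with
  | zero => exact ⟨.zero, fun _ => rfl⟩
  | succ => exact ⟨.succ, fun _ => rfl⟩
  | left => exact ⟨.left, fun _ => rfl⟩
  | right => exact ⟨.right, fun _ => rfl⟩
  | pair _ _ h1 h2 =>
    obtain ⟨C, hC⟩ := h1
    obtain ⟨E, hE⟩ := h2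
    exact ⟨.pair C E, fun n => by simp [PCode.run, hC, hE]⟩
  | comp _ _ h1 h2 =>
    obtain ⟨C, hC⟩ := h1
    obtain ⟨E, hE⟩ := h2
    exact ⟨.comp C E, fun n => by simp [PCode.run, hC, hE]⟩
  | prec _ _ h1 h2 =>
    obtain ⟨C, hC⟩ := h1
    obtain ⟨E, hE⟩ := h2
    exact ⟨.prec C E, fun n => by simp [PCode.run, hC, hE, Nat.unpaired]⟩

lemma PCode.run_prec_zero (f g : PCode) (a : ℕ) :
    (PCode.prec f g).run (Nat.pair a 0) = f.run a := by
  simp [PCode.run]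

lemma PCode.run_prec_succ (f g : PCode) (a n : ℕ) :
    (PCode.prec f g).run (Nat.pair a (n + 1)) =
      g.run (Nat.pair a (Nat.pair n ((PCode.prec f g).run (Nat.pair a n)))) := by
  simp [PCode.run]

/-- One step in the enumeration of pairs. -/
lemma pair_step1 {x y : ℕ} (h : x + 1 < y) : Nat.pair (x + 1) y = Nat.pair x y + 1 := by
  simp only [Nat.pair]
  split_ifs <;> first | omega | ring

lemma pair_step2 (x : ℕ) : Nat.pair (x + 1) 0 = Nat.pair x (x + 1) + 1 := by
  simp only [Nat.pair]
  split_ifs <;> first | omega | ring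

lemma pair_step3 {x y : ℕ} (h : y < x) : Nat.pair x (y + 1) = Nat.pair x y + 1 := by
  simp only [Nat.pair]
  split_ifs <;> first | omega | ring

lemma pair_step4 (x : ℕ) : Nat.pair 0 (x + 1) = Nat.pair x x + 1 := by
  simp only [Nat.pair]
  split_ifs <;> first | omega | ring

lemma pair_zero_zero : Nat.pair 0 0 = 0 := by simp [Nat.pair]

lemma pair_cases (x y z : ℕ) (h : Nat.pair x y = z) :
    (x = 0 ∧ y = 0 ∧ z = 0) ∨ ∃ x' y' z', z' + 1 = z ∧ Nat.pair x' y' = z' ∧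
      ((x' < y' ∧ x' + 1 = x ∧ x < y' ∧ y = y') ∨ (x' + 1 = y' ∧ x = y' ∧ y = 0) ∨
       (y' < x' ∧ x = x' ∧ y' + 1 = y) ∨ (y' = x' ∧ x = 0 ∧ x' + 1 = y)) := by
  rcases z with _ | z
  · left
    have := Nat.pair_eq_pair.1 (h.trans pair_zero_zero.symm)
    simp [this.1, this.2]
  · right
    have hz : Nat.pair z.unpair.1 z.unpair.2 = z := Nat.pair_unpair z
    generalize z.unpair.1 = x' at hz
    generalize z.unpair.2 = y' at hz
    refine ⟨x', y', z, rfl, hz, ?_⟩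
    rw [← hz] at h
    rcases lt_trichotomy x' y' with h1 | h1 | h1
    · rcases lt_or_eq_of_le (Nat.succ_le_of_lt h1) with h2 | h2
      · rw [← pair_step1 h2, Nat.pair_eq_pair] at h
        left; omega
      · have h2 : x' + 1 = y' := h2
        subst h2
        rw [← pair_step2, Nat.pair_eq_pair] at h
        right; left; omega
    · subst h1
      rw [← pair_step4, Nat.pair_eq_pair] at h
      right; right; right; omega
    · rw [← pair_step3 h1, Nat.pair_eq_pair] at h
      right; right; left; omega

/-! ### Soundness: finite models of the axioms represent true computations -/

section sound

variable {D : Type} {P N : D → D → D → D → Prop} {k : ℕ → D} (S : Setoid D)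

/-- Number represented by an element: the number of classes below it. -/
noncomputable def rk (P : D → D → D → D → Prop) (k : ℕ → D) (x : D) : ℕ :=
  Set.ncard ((Quotient.mk S) '' {y | P (k 0) y x x})

structure Good (P N : D → D → D → D → Prop) (k : ℕ → D) (S : Setoid D) : Prop where
  fin : Finite (Quotient S)
  hPN : ∀ x y u v, P x y u v → N x y u v → False
  hP : ∀ t x y u v, S.r x y → P t x u v → P t y u v
  hP2 : ∀ t z x y, S.r x y → P t z x x → P t z y y
  hA : AxS P N S.r k

variable {S}

lemma rk_lt (G : Good P N k S) {x y : D} (h : P (k 0) x y y) : rk S P k x < rk S P k y := by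
  have := G.fin
  apply Set.ncard_lt_ncard _ (Set.toFinite _)
  rw [Set.ssubset_iff_exists]
  refine ⟨?_, Quotient.mk S x, ⟨x, h, rfl⟩, ?_⟩
  · rintro _ ⟨z, hz, rfl⟩
    refine ⟨z, ?_, rfl⟩
    rcases G.hA.trans z x y with h1 | h1 | h1
    · exact (G.hPN _ _ _ _ hz h1).elim
    · exact (G.hPN _ _ _ _ h h1).elim
    · exact h1
  · rintro ⟨z, hz, hzx⟩
    exact G.hPN _ _ _ _ (G.hP _ _ _ _ _ (Quotient.exact hzx) hz) (G.hA.irr x)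

lemma rk_zero (G : Good P N k S) : rk S P k (k 0) = 0 := by
  have := G.fin
  rw [rk, Set.ncard_eq_zero (Set.toFinite _), Set.image_eq_empty, Set.eq_empty_iff_forall_notMem]
  intro x hx
  exact G.hPN _ _ _ _ hx (G.hA.zero x)

lemma rk_succ (G : Good P N k S) {x y : D} (h : P (k 1) x y y) : rk S P k x + 1 = rk S P k y := by
  have := G.fin
  rcases G.hA.succ x y with h1 | ⟨h1, h2⟩
  · exact (G.hPN _ _ _ _ h h1).elim
  have hx : Quotient.mk S x ∉ (Quotient.mk S) '' {z | P (k 0) z x x} := by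
    rintro ⟨z, hz, hzx⟩
    exact G.hPN _ _ _ _ (G.hP _ _ _ _ _ (Quotient.exact hzx) hz) (G.hA.irr x)
  rw [rk, rk, ← Set.ncard_insert_of_notMem hx (Set.toFinite _)]
  congr 1
  ext q
  constructor
  · rintro (rfl | ⟨z, hz, rfl⟩)
    · exact ⟨x, h1, rfl⟩
    · refine ⟨z, ?_, rfl⟩
      rcases G.hA.trans z x y with h3 | h3 | h3
      · exact (G.hPN _ _ _ _ hz h3).elim
      · exact (G.hPN _ _ _ _ h1 h3).elim
      · exact h3
  · rintro ⟨z, hz, rfl⟩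
    rcases h2 z with h3 | h3 | h3
    · exact (G.hPN _ _ _ _ hz h3).elim
    · exact Or.inr ⟨z, h3, rfl⟩
    · exact Or.inl (Quotient.sound h3)

lemma rk_eq (G : Good P N k S) {x y : D} (h : S.r x y) : rk S P k x = rk S P k y := by
  rw [rk, rk]
  congr 2
  ext z
  exact ⟨G.hP2 _ _ _ _ h, G.hP2 _ _ _ _ (S.symm h)⟩

lemma rk_const (G : Good P N k S) : rk S P k (k 1) = 1 ∧ rk S P k (k 2) = 2 ∧ rk S P k (k 3) = 3 ∧
    rk S P k (k 4) = 4 ∧ rk S P k (k 5) = 5 ∧ rk S P k (k 6) = 6 := by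
  obtain ⟨h1, h2, h3, h4, h5, h6⟩ := G.hA.chain
  have := rk_zero G
  have := rk_succ G h1
  have := rk_succ G h2
  have := rk_succ G h3
  have := rk_succ G h4
  have := rk_succ G h5
  have := rk_succ G h6
  omega

lemma rk_pair (G : Good P N k S) {x y z : D} (h : P (k 2) x y z) :
    Nat.pair (rk S P k x) (rk S P k y) = rk S P k z := by
  induction hn : rk S P k z generalizing x y z with
  | zero =>
    rcases G.hA.pair x y z with h1 | h1 | ⟨x', y', z', h1, h2, h3⟩
    · exact (G.hPN _ _ _ _ h h1).elim
    · rw [rk_eq G h1.1, rk_eq G h1.2.1, rk_zero G, pair_zero_zero]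
    · have := rk_succ G h1
      omega
  | succ n ih =>
    rcases G.hA.pair x y z with h1 | h1 | ⟨x', y', z', h1, h2, h3⟩
    · exact (G.hPN _ _ _ _ h h1).elim
    · have := rk_eq G h1.2.2
      rw [rk_zero G] at this
      omega
    · have e1 := rk_succ G h1
      have e2 := ih h2 (by omega)
      rw [← e2]
      rcases h3 with ⟨h3, h4, h5, h6⟩ | ⟨h3, h4, h5⟩ | ⟨h3, h4, h5⟩ | ⟨h3, h4, h5⟩
      · have e4 := rk_succ G h4
        have e5 := rk_lt G h5
        rw [rk_eq G h6, ← e4, pair_step1 (by omega)]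
      · rw [rk_eq G h4, rk_eq G h5, rk_zero G, ← rk_succ G h3, pair_step2]
      · rw [rk_eq G h4, ← rk_succ G h5, pair_step3 (rk_lt G h3)]
      · rw [rk_eq G h4, rk_zero G, ← rk_succ G h5, rk_eq G h3, pair_step4]

lemma rk_eval (G : Good P N k S) (C : PCode) {c x y : D} (hc : rk S P k c = C.enc)
    (h : P (k 3) c x y) : rk S P k y = C.run (rk S P k x) := by
  obtain ⟨e1, e2, e3, e4, e5, e6⟩ := rk_const G
  have e0 := rk_zero G
  induction C generalizing c x y with
  | zero =>
    obtain ⟨t, r, h1, h2⟩ := (G.hA.eval c x y).resolve_left (G.hPN _ _ _ _ h)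
    have h1 := rk_pair G h1
    rw [hc, PCode.enc, Nat.pair_eq_pair] at h1
    rcases h2 with ⟨h2, h3⟩ | ⟨h2, h3⟩ | ⟨h2, h3⟩ | ⟨h2, h3⟩ |
        ⟨f, g, h3, ⟨h2, h4⟩ | ⟨h2, h4⟩ | ⟨h2, h4⟩⟩ <;> have h2 := rk_eq G h2 <;> try omega
    rw [rk_eq G h3, e0, PCode.run]
  | succ =>
    obtain ⟨t, r, h1, h2⟩ := (G.hA.eval c x y).resolve_left (G.hPN _ _ _ _ h)
    have h1 := rk_pair G h1
    rw [hc, PCode.enc, Nat.pair_eq_pair] at h1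
    rcases h2 with ⟨h2, h3⟩ | ⟨h2, h3⟩ | ⟨h2, h3⟩ | ⟨h2, h3⟩ |
        ⟨f, g, h3, ⟨h2, h4⟩ | ⟨h2, h4⟩ | ⟨h2, h4⟩⟩ <;> have h2 := rk_eq G h2 <;> try omega
    rw [← rk_succ G h3, PCode.run]
  | left =>
    obtain ⟨t, r, h1, h2⟩ := (G.hA.eval c x y).resolve_left (G.hPN _ _ _ _ h)
    have h1 := rk_pair G h1
    rw [hc, PCode.enc, Nat.pair_eq_pair] at h1
    rcases h2 with ⟨h2, h3⟩ | ⟨h2, h3⟩ | ⟨h2, h3⟩ | ⟨h2, h3⟩ |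
        ⟨f, g, h3, ⟨h2, h4⟩ | ⟨h2, h4⟩ | ⟨h2, h4⟩⟩ <;> have h2 := rk_eq G h2 <;> try omega
    obtain ⟨v, h3⟩ := h3
    rw [← rk_pair G h3, PCode.run, Nat.unpair_pair]
  | right =>
    obtain ⟨t, r, h1, h2⟩ := (G.hA.eval c x y).resolve_left (G.hPN _ _ _ _ h)
    have h1 := rk_pair G h1
    rw [hc, PCode.enc, Nat.pair_eq_pair] at h1
    rcases h2 with ⟨h2, h3⟩ | ⟨h2, h3⟩ | ⟨h2, h3⟩ | ⟨h2, h3⟩ |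
        ⟨f, g, h3, ⟨h2, h4⟩ | ⟨h2, h4⟩ | ⟨h2, h4⟩⟩ <;> have h2 := rk_eq G h2 <;> try omega
    obtain ⟨v, h3⟩ := h3
    rw [← rk_pair G h3, PCode.run, Nat.unpair_pair]
  | pair C E ihC ihE =>
    obtain ⟨t, r, h1, h2⟩ := (G.hA.eval c x y).resolve_left (G.hPN _ _ _ _ h)
    have h1 := rk_pair G h1
    rw [hc, PCode.enc, Nat.pair_eq_pair] at h1
    rcases h2 with ⟨h2, h3⟩ | ⟨h2, h3⟩ | ⟨h2, h3⟩ | ⟨h2, h3⟩ |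
        ⟨f, g, h3, ⟨h2, h4⟩ | ⟨h2, h4⟩ | ⟨h2, h4⟩⟩ <;> have h2 := rk_eq G h2 <;> try omega
    obtain ⟨u, v, h4, h5, h6⟩ := h4
    have h3 := rk_pair G h3
    rw [h1.2, Nat.pair_eq_pair] at h3
    rw [← rk_pair G h6, ihC h3.1 h4, ihE h3.2 h5, PCode.run]
  | comp C E ihC ihE =>
    obtain ⟨t, r, h1, h2⟩ := (G.hA.eval c x y).resolve_left (G.hPN _ _ _ _ h)
    have h1 := rk_pair G h1
    rw [hc, PCode.enc, Nat.pair_eq_pair] at h1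
    rcases h2 with ⟨h2, h3⟩ | ⟨h2, h3⟩ | ⟨h2, h3⟩ | ⟨h2, h3⟩ |
        ⟨f, g, h3, ⟨h2, h4⟩ | ⟨h2, h4⟩ | ⟨h2, h4⟩⟩ <;> have h2 := rk_eq G h2 <;> try omega
    obtain ⟨u, h4, h5⟩ := h4
    have h3 := rk_pair G h3
    rw [h1.2, Nat.pair_eq_pair] at h3
    rw [ihC h3.1 h5, ihE h3.2 h4, PCode.run]
  | prec C E ihC ihE =>
    have key : ∀ (l a : ℕ) (x y : D), rk S P k x = Nat.pair a l → P (k 3) c x y →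
        rk S P k y = (PCode.prec C E).run (Nat.pair a l) := by
      intro l b
      induction l with
      | zero =>
        intro x y hx h
        obtain ⟨t, r, h1, h2⟩ := (G.hA.eval c x y).resolve_left (G.hPN _ _ _ _ h)
        have h1 := rk_pair G h1
        rw [hc, PCode.enc, Nat.pair_eq_pair] at h1
        rcases h2 with ⟨h2, h3⟩ | ⟨h2, h3⟩ | ⟨h2, h3⟩ | ⟨h2, h3⟩ |
            ⟨f, g, h3, ⟨h2, h4⟩ | ⟨h2, h4⟩ | ⟨h2, h4⟩⟩ <;> have h2 := rk_eq G h2 <;> try omega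
        have h3 := rk_pair G h3
        rw [h1.2, Nat.pair_eq_pair] at h3
        obtain ⟨a, n, h4, h5⟩ := h4
        have h4 := rk_pair G h4
        rw [hx, Nat.pair_eq_pair] at h4
        rcases h5 with ⟨h5, h6⟩ | ⟨m, q, i, p, p', h5, -⟩
        · rw [ihC h3.1 h6, h4.1, PCode.run_prec_zero]
        · have := rk_succ G h5
          omega
      | succ l ih =>
        intro x y hx h
        obtain ⟨t, r, h1, h2⟩ := (G.hA.eval c x y).resolve_left (G.hPN _ _ _ _ h)
        have h1 := rk_pair G h1
        rw [hc, PCode.enc, Nat.pair_eq_pair] at h1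
        rcases h2 with ⟨h2, h3⟩ | ⟨h2, h3⟩ | ⟨h2, h3⟩ | ⟨h2, h3⟩ |
            ⟨f, g, h3, ⟨h2, h4⟩ | ⟨h2, h4⟩ | ⟨h2, h4⟩⟩ <;> have h2 := rk_eq G h2 <;> try omega
        have h3 := rk_pair G h3
        rw [h1.2, Nat.pair_eq_pair] at h3
        obtain ⟨a, n, h4, h5⟩ := h4
        have h4 := rk_pair G h4
        rw [hx, Nat.pair_eq_pair] at h4
        rcases h5 with ⟨h5, h6⟩ | ⟨m, q, i, p, p', h5, h6, h7, h8, h9, h10⟩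
        · have := rk_eq G h5
          omega
        · have h5 := rk_succ G h5
          have hm : rk S P k m = l := by omega
          have h6 := rk_pair G h6
          rw [hm, h4.1] at h6
          have h7 := ih q i h6.symm h7
          rw [ihE h3.2 h10, ← rk_pair G h9, ← rk_pair G h8, h7, hm, h4.1, PCode.run_prec_succ]
    have := key (rk S P k x).unpair.2 (rk S P k x).unpair.1 x y (Nat.pair_unpair _).symm h
    rwa [Nat.pair_unpair] at this

end sound

/-! ### Completeness: computations give finite models -/

inductive Ev (N : ℕ) : Fin (N + 1) → Fin (N + 1) → Fin (N + 1) → Prop where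
  | zero {c x y h r : Fin (N + 1)} :
      Nat.pair h.1 r.1 = c.1 → h.1 = 0 → y.1 = 0 → Ev N c x y
  | succ {c x y h r : Fin (N + 1)} :
      Nat.pair h.1 r.1 = c.1 → h.1 = 1 → x.1 + 1 = y.1 → Ev N c x y
  | left {c x y h r v : Fin (N + 1)} :
      Nat.pair h.1 r.1 = c.1 → h.1 = 2 → Nat.pair y.1 v.1 = x.1 → Ev N c x y
  | right {c x y h r v : Fin (N + 1)} :
      Nat.pair h.1 r.1 = c.1 → h.1 = 3 → Nat.pair v.1 y.1 = x.1 → Ev N c x y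
  | pair {c x y h r f g u v : Fin (N + 1)} :
      Nat.pair h.1 r.1 = c.1 → h.1 = 4 → Nat.pair f.1 g.1 = r.1 →
      Ev N f x u → Ev N g x v → Nat.pair u.1 v.1 = y.1 → Ev N c x y
  | comp {c x y h r f g u : Fin (N + 1)} :
      Nat.pair h.1 r.1 = c.1 → h.1 = 5 → Nat.pair f.1 g.1 = r.1 →
      Ev N g x u → Ev N f u y → Ev N c x y
  | precZ {c x y h r f g a n : Fin (N + 1)} :
      Nat.pair h.1 r.1 = c.1 → h.1 = 6 → Nat.pair f.1 g.1 = r.1 →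
      Nat.pair a.1 n.1 = x.1 → n.1 = 0 → Ev N f a y → Ev N c x y
  | precS {c x y h r f g a n m q i p p' : Fin (N + 1)} :
      Nat.pair h.1 r.1 = c.1 → h.1 = 6 →
      Nat.pair f.1 g.1 = r.1 → Nat.pair a.1 n.1 = x.1 → m.1 + 1 = n.1 →
      Nat.pair a.1 m.1 = q.1 → Ev N c q i → Nat.pair m.1 i.1 = p.1 → Nat.pair a.1 p.1 = p'.1 →
      Ev N g p' y → Ev N c x y

/-- The 4-ary relation of the finite model. -/
def QD (N : ℕ) (t x y z : Fin (N + 1)) : Prop :=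
  (t.1 = 0 ∧ x.1 < y.1) ∨ (t.1 = 1 ∧ x.1 + 1 = y.1) ∨ (t.1 = 2 ∧ Nat.pair x.1 y.1 = z.1) ∨
    (t.1 = 3 ∧ Ev N x y z)

def kD (N : ℕ) (i : ℕ) : Fin (N + 1) := ⟨min i N, by omega⟩

lemma fin_pair {N : ℕ} {c : Fin (N + 1)} {a b : ℕ} (h : Nat.pair a b = c.1) :
    ∃ (a' b' : Fin (N + 1)), a'.1 = a ∧ b'.1 = b := by
  have h1 := Nat.left_le_pair a b
  have h2 := Nat.right_le_pair a b
  exact ⟨⟨a, by omega⟩, ⟨b, by omega⟩, rfl, rfl⟩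

lemma Ev_exists (C : PCode) : ∀ x : ℕ, ∃ N0, ∀ N ≥ N0, ∀ c x' y : Fin (N + 1),
    c.1 = C.enc → x'.1 = x → y.1 = C.run x → Ev N c x' y := by
  induction C with
  | zero =>
    refine fun x => ⟨0, fun N hN c x' y hc hx hy => ?_⟩
    obtain ⟨h, r, hh, hr⟩ := fin_pair hc.symm
    exact .zero (h := h) (r := r) (by rw [hh, hr, hc, PCode.enc]) hh hy
  | succ =>
    refine fun x => ⟨0, fun N hN c x' y hc hx hy => ?_⟩
    obtain ⟨h, r, hh, hr⟩ := fin_pair hc.symm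
    exact .succ (h := h) (r := r) (by rw [hh, hr, hc, PCode.enc]) hh (by rw [hx, hy, PCode.run])
  | left =>
    refine fun x => ⟨0, fun N hN c x' y hc hx hy => ?_⟩
    obtain ⟨h, r, hh, hr⟩ := fin_pair hc.symm
    obtain ⟨u, v, hu, hv⟩ := fin_pair (Nat.pair_unpair x'.1)
    refine .left (h := h) (r := r) (v := v) (by rw [hh, hr, hc, PCode.enc]) hh ?_
    rw [hy, hv, PCode.run, hx, Nat.pair_unpair]
  | right =>
    refine fun x => ⟨0, fun N hN c x' y hc hx hy => ?_⟩
    obtain ⟨h, r, hh, hr⟩ := fin_pair hc.symm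
    obtain ⟨u, v, hu, hv⟩ := fin_pair (Nat.pair_unpair x'.1)
    refine .right (h := h) (r := r) (v := u) (by rw [hh, hr, hc, PCode.enc]) hh ?_
    rw [hy, hu, PCode.run, hx, Nat.pair_unpair]
  | pair C E ihC ihE =>
    intro x
    obtain ⟨N1, h1⟩ := ihC x
    obtain ⟨N2, h2⟩ := ihE x
    refine ⟨max N1 N2, fun N hN c x' y hc hx hy => ?_⟩
    obtain ⟨h, r, hh, hr⟩ := fin_pair hc.symm
    obtain ⟨f, g, hf, hg⟩ := fin_pair hr.symm
    obtain ⟨u, v, hu, hv⟩ := fin_pair hy.symm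
    exact .pair (h := h) (r := r) (f := f) (g := g) (u := u) (v := v)
      (by rw [hh, hr, hc, PCode.enc]) hh (by rw [hf, hg, hr])
      (h1 N (by omega) f x' u hf hx hu) (h2 N (by omega) g x' v hg hx hv)
      (by rw [hu, hv, hy, PCode.run])
  | comp C E ihC ihE =>
    intro x
    obtain ⟨N1, h1⟩ := ihE x
    obtain ⟨N2, h2⟩ := ihC (E.run x)
    refine ⟨max (E.run x) (max N1 N2), fun N hN c x' y hc hx hy => ?_⟩
    obtain ⟨h, r, hh, hr⟩ := fin_pair hc.symm
    obtain ⟨f, g, hf, hg⟩ := fin_pair hr.symm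
    exact .comp (h := h) (r := r) (f := f) (g := g) (u := ⟨E.run x, by omega⟩)
      (by rw [hh, hr, hc, PCode.enc]) hh (by rw [hf, hg, hr])
      (h1 N (by omega) g x' _ hg hx rfl) (h2 N (by omega) f _ y hf rfl hy)
  | prec C E ihC ihE =>
    have key : ∀ a l : ℕ, ∃ N0, ∀ N ≥ N0, ∀ c x' y : Fin (N + 1),
        c.1 = (PCode.prec C E).enc → x'.1 = Nat.pair a l →
          y.1 = (PCode.prec C E).run (Nat.pair a l) → Ev N c x' y := by
      intro a l
      induction l with
      | zero =>
        obtain ⟨N1, h1⟩ := ihC a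
        refine ⟨N1, fun N hN c x' y hc hx hy => ?_⟩
        obtain ⟨h, r, hh, hr⟩ := fin_pair hc.symm
        obtain ⟨f, g, hf, hg⟩ := fin_pair hr.symm
        obtain ⟨a', n, ha, hn⟩ := fin_pair hx.symm
        exact .precZ (h := h) (r := r) (f := f) (g := g) (a := a') (n := n)
          (by rw [hh, hr, hc, PCode.enc]) hh (by rw [hf, hg, hr]) (by rw [ha, hn, hx]) hn
          (h1 N (by omega) f a' y hf ha (by rw [hy, PCode.run_prec_zero]))
      | succ l ih =>
        obtain ⟨N1, h1⟩ := ih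
        obtain ⟨N2, h2⟩ := ihE (Nat.pair a (Nat.pair l ((PCode.prec C E).run (Nat.pair a l))))
        refine ⟨max (max N1 N2) (max (Nat.pair a l)
          (Nat.pair a (Nat.pair l ((PCode.prec C E).run (Nat.pair a l))))),
          fun N hN c x' y hc hx hy => ?_⟩
        obtain ⟨h, r, hh, hr⟩ := fin_pair hc.symm
        obtain ⟨f, g, hf, hg⟩ := fin_pair hr.symm
        obtain ⟨a', n, ha, hn⟩ := fin_pair hx.symm
        obtain ⟨p', hp'⟩ : ∃ p' : Fin (N + 1), p'.1 =
            Nat.pair a (Nat.pair l ((PCode.prec C E).run (Nat.pair a l))) := ⟨⟨Nat.pair a (Nat.pair l ((PCode.prec C E).run (Nat.pair a l))), by omega⟩, rfl⟩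
        obtain ⟨q, hq⟩ : ∃ q : Fin (N + 1), q.1 = Nat.pair a l := ⟨⟨Nat.pair a l, by omega⟩, rfl⟩
        obtain ⟨_, p, _, hp⟩ := fin_pair hp'.symm
        obtain ⟨m, i, hm, hi⟩ := fin_pair hp.symm
        exact .precS (h := h) (r := r) (f := f) (g := g) (a := a') (n := n) (m := m) (q := q)
          (i := i) (p := p) (p' := p')
          (by rw [hh, hr, hc, PCode.enc]) hh (by rw [hf, hg, hr]) (by rw [ha, hn, hx])
          (by rw [hm, hn]) (by rw [ha, hm, hq])
          (h1 N (by omega) c q i hc hq hi) (by rw [hm, hi, hp]) (by rw [ha, hp, hp'])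
          (h2 N (by omega) g p' y hg hp' (by rw [hy, PCode.run_prec_succ]))
    intro x
    have := key x.unpair.1 x.unpair.2
    rwa [Nat.pair_unpair] at this

lemma kD_val {N : ℕ} {i : ℕ} (h : i ≤ N) : (kD N i).1 = i := min_eq_left h

lemma QD0 {N : ℕ} (hN : 6 ≤ N) (x y z) : QD N (kD N 0) x y z ↔ x.1 < y.1 := by
  have : (kD N 0).1 = 0 := kD_val (by omega)
  simp [QD, this]

lemma QD1 {N : ℕ} (hN : 6 ≤ N) (x y z) : QD N (kD N 1) x y z ↔ x.1 + 1 = y.1 := by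
  have : (kD N 1).1 = 1 := kD_val (by omega)
  simp [QD, this]

lemma QD2 {N : ℕ} (hN : 6 ≤ N) (x y z) : QD N (kD N 2) x y z ↔ Nat.pair x.1 y.1 = z.1 := by
  have : (kD N 2).1 = 2 := kD_val (by omega)
  simp [QD, this]

lemma QD3 {N : ℕ} (hN : 6 ≤ N) (x y z) : QD N (kD N 3) x y z ↔ Ev N x y z := by
  have : (kD N 3).1 = 3 := kD_val (by omega)
  simp [QD, this]

lemma AxS_QD {N : ℕ} (hN : 6 ≤ N) :
    AxS (QD N) (fun t x y z => ¬ QD N t x y z) Eq (kD N) where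
  irr x := by rw [QD0 hN]; omega
  trans x y z := by simp only [QD0 hN]; omega
  zero x := by rw [QD0 hN, kD_val (by omega)]; omega
  succ x y := by
    simp only [QD0 hN, QD1 hN, Fin.ext_iff]
    by_cases h : x.1 + 1 = y.1
    · right
      exact ⟨by omega, fun z => by omega⟩
    · exact Or.inl h
  chain := by
    simp only [QD1 hN]
    rw [kD_val (by omega), kD_val (by omega), kD_val (by omega), kD_val (by omega),
      kD_val (by omega), kD_val (by omega), kD_val (by omega)]
    omega
  pair x y z := by
    rw [QD2 hN, or_iff_not_imp_left, not_not]
    intro h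
    have k0 : (kD N 0).1 = 0 := kD_val (by omega)
    simp only [JPair, QD0 hN, QD1 hN, QD2 hN, Fin.ext_iff, k0]
    rcases pair_cases _ _ _ h with h1 | ⟨x', y', z', h1, h2, h3⟩
    · exact Or.inl h1
    · right
      obtain ⟨z', rfl⟩ : ∃ z'' : Fin (N + 1), z''.1 = z' := ⟨⟨z', by omega⟩, rfl⟩
      obtain ⟨x', y', rfl, rfl⟩ := fin_pair h2
      exact ⟨x', y', z', h1, h2, h3⟩
  eval c x y := by
    rw [QD3 hN, or_iff_not_imp_left, not_not]
    intro h
    have k0 : (kD N 0).1 = 0 := kD_val (by omega)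
    have k1 : (kD N 1).1 = 1 := kD_val (by omega)
    have k2 : (kD N 2).1 = 2 := kD_val (by omega)
    have k3 : (kD N 3).1 = 3 := kD_val (by omega)
    have k4 : (kD N 4).1 = 4 := kD_val (by omega)
    have k5 : (kD N 5).1 = 5 := kD_val (by omega)
    have k6 : (kD N 6).1 = 6 := kD_val (by omega)
    simp only [JEval, QD1 hN, QD2 hN, QD3 hN, Fin.ext_iff, k0, k1, k2, k3, k4, k5, k6]
    cases h with
    | zero h1 h2 h3 => exact ⟨_, _, h1, .inl ⟨h2, h3⟩⟩
    | succ h1 h2 h3 => exact ⟨_, _, h1, .inr <| .inl ⟨h2, h3⟩⟩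
    | left h1 h2 h3 => exact ⟨_, _, h1, .inr <| .inr <| .inl ⟨h2, _, h3⟩⟩
    | right h1 h2 h3 => exact ⟨_, _, h1, .inr <| .inr <| .inr <| .inl ⟨h2, _, h3⟩⟩
    | pair h1 h2 h3 h4 h5 h6 =>
      exact ⟨_, _, h1, .inr <| .inr <| .inr <| .inr ⟨_, _, h3, .inl ⟨h2, _, _, h4, h5, h6⟩⟩⟩
    | comp h1 h2 h3 h4 h5 =>
      exact ⟨_, _, h1, .inr <| .inr <| .inr <| .inr ⟨_, _, h3, .inr <| .inl ⟨h2, _, h4, h5⟩⟩⟩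
    | precZ h1 h2 h3 h4 h5 h6 =>
      exact ⟨_, _, h1, .inr <| .inr <| .inr <| .inr ⟨_, _, h3, .inr <| .inr
        ⟨h2, _, _, h4, .inl ⟨h5, h6⟩⟩⟩⟩
    | precS h1 h2 h3 h4 h5 h6 h7 h8 h9 h10 =>
      exact ⟨_, _, h1, .inr <| .inr <| .inr <| .inr ⟨_, _, h3, .inr <| .inr
        ⟨h2, _, _, h4, .inr ⟨_, _, _, _, _, h5, h6, h7, h8, h9, h10⟩⟩⟩⟩


/-! ### Support of the special formulas -/

section special

variable (M : Model sig19) (s : Set M.W) (g : ℕ → M.D)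

lemma supp_theta : Support M s g (thetaOf cA cB) ↔
    ∃ d e, ∀ w ∈ s, M.eqI w d (atA M w) → M.eqI w e (atB M w) → False := by
  simp only [thetaOf, Formula.neg, Support, val_cA, val_cB, Term.val]
  refine exists_congr fun d => exists_congr fun e => ?_
  simp only [Function.update_apply]
  constructor
  · intro h w hw h1 h2
    have := h {w} (by simpa using hw)
      ⟨by rintro w' rfl; simpa using h1, by rintro w' rfl; simpa using h2⟩
    simp at this
  · intro h t ht h1
    by_contra hne
    obtain ⟨w, hw⟩ := Set.nonempty_iff_ne_empty.mpr hne
    exact h w (ht hw) (by simpa using h1.1 w hw) (by simpa using h1.2 w hw)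

lemma supp_rho : Support M s g rho ↔
    ∀ x y, (∀ w ∈ s, M.eqI w x y) ∨ (∀ w ∈ s, ¬ M.eqI w x y) := by
  simp only [rho, Formula.qm, Formula.neg, Support, Term.val]
  refine forall_congr' fun d => forall_congr' fun e => ?_
  simp only [Function.update_apply]
  refine or_congr (by simp) ?_
  constructor
  · intro h w hw h1
    have := h {w} (by simpa using hw) (by rintro w' rfl; simpa using h1)
    simp at this
  · intro h t ht h1
    by_contra hne
    obtain ⟨w, hw⟩ := Set.nonempty_iff_ne_empty.mpr hne
    exact h w (ht hw) (by simpa using h1 w hw)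

lemma supp_lam (c : Term sig19) (v : M.W → M.D) (hv : ∀ w g, c.val M w g = v w) :
    Support M s g (lam 0 c) ↔ ∃ d, ∀ w ∈ s, M.eqI w d (v w) := by
  simp [lam, Support, hv, Term.val]

lemma supp_iexNe (c : Term sig19) (v : M.W → M.D) (hv : ∀ w g, c.val M w g = v w) :
    Support M s g (iexNe c) ↔ ∃ d, ∀ w ∈ s, ¬ M.eqI w d (v w) := by
  simp only [iexNe, neTm, Formula.neg, Support, hv, Term.val, Function.update_self]
  refine exists_congr fun d => ?_
  constructor
  · intro h w hw h1
    have := h {w} (by simpa using hw) (by rintro w' rfl; exact h1)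
    simp at this
  · intro h t ht h1
    by_contra hne
    obtain ⟨w, hw⟩ := Set.nonempty_iff_ne_empty.mpr hne
    exact h w (ht hw) (h1 w hw)

lemma supp_eta : Support M s g (etaOf cA cB) ↔
    ∀ t ⊆ s, (∀ t' ⊆ t, (∃ d, ∀ w ∈ t', M.eqI w d (atA M w)) → ∃ d, ∀ w ∈ t', M.eqI w d (atB M w)) →
      (∀ t' ⊆ t, (∃ d, ∀ w ∈ t', M.eqI w d (atB M w)) → ∃ d, ∀ w ∈ t', M.eqI w d (atA M w)) →
      (∃ d, ∀ w ∈ t, ¬ M.eqI w d (atB M w)) → ∃ d, ∀ w ∈ t, ¬ M.eqI w d (atA M w) := by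
  have hA : ∀ w g, cA.val M w g = atA M w := fun w g => val_cA M g w
  have hB : ∀ w g, cB.val M w g = atB M w := fun w g => val_cB M g w
  simp only [etaOf, Support, supp_lam M _ _ cA _ hA, supp_lam M _ _ cB _ hB,
    supp_iexNe M _ _ cA _ hA, supp_iexNe M _ _ cB _ hB]
  exact ⟨fun h t ht h1 h2 h3 => h t ht ⟨h1, h2, h3⟩, fun h t ht h1 => h t ht h1.1 h1.2.1 h1.2.2⟩

end special

lemma exists_inj_not_surj (Q : Type) [Infinite Q] :
    ∃ (f : Q → Q) (q : Q), Function.Injective f ∧ ∀ x, f x ≠ q := by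
  have h : Cardinal.mk (Option Q) = Cardinal.mk Q := by
    rw [Cardinal.mk_option, Cardinal.add_one_eq (Cardinal.aleph0_le_mk Q)]
  obtain ⟨e⟩ := Cardinal.eq.1 h
  refine ⟨fun x => e (some x), e none, fun x y hxy => by simpa using hxy, fun x hx => ?_⟩
  simp at hx

def stSetoid (M : Model sig19) (s : Set M.W) : Setoid M.D where
  r := QE M s
  iseqv := ⟨fun _ w _ => (M.eqEquiv w).refl _, fun h w hw => (M.eqEquiv w).symm (h w hw),
    fun h1 h2 w hw => (M.eqEquiv w).trans (h1 w hw) (h2 w hw)⟩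

lemma finite_quot (M : Model sig19) (s : Set M.W) (g : ℕ → M.D)
    (hr : Support M s g rho) (he : Support M s g (etaOf cA cB))
    (ht : ¬ Support M s g (thetaOf cA cB)) : Finite (Quotient (stSetoid M s)) := by
  rw [supp_rho] at hr
  rw [supp_eta] at he
  rw [supp_theta] at ht
  push Not at ht
  by_contra hinf
  rw [not_finite_iff_infinite] at hinf
  obtain ⟨f, q, hf, hq⟩ := exists_inj_not_surj (Quotient (stSetoid M s))
  have key : ∀ w ∈ s, ∀ x y, M.eqI w x y ↔
      Quotient.mk (stSetoid M s) x = Quotient.mk (stSetoid M s) y := by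
    intro w hw x y
    constructor
    · intro h
      refine Quotient.sound ((hr x y).resolve_right fun h1 => h1 w hw h)
    · intro h
      exact (show QE M s x y from Quotient.exact h) w hw
  have hex : ∃ d, ∀ w ∈ {w ∈ s | Quotient.mk (stSetoid M s) (atB M w) =
      f (Quotient.mk (stSetoid M s) (atA M w))}, ¬ M.eqI w d (atA M w) := by
    refine he _ (fun w hw => hw.1) ?_ ?_ ?_
    · rintro t' ht' ⟨d, hd⟩
      refine ⟨(f (Quotient.mk _ d)).out, fun w hw => ?_⟩
      have hw' := ht' hw
      have h1 := hd w hw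
      rw [key w hw'.1] at h1 ⊢
      rw [hw'.2, ← h1, Quotient.out_eq]
    · rintro t' ht' ⟨d, hd⟩
      rcases t'.eq_empty_or_nonempty with rfl | ⟨w0, hw0⟩
      · exact ⟨d, by simp⟩
      · refine ⟨atA M w0, fun w hw => ?_⟩
        have h1 := hd w hw
        have h2 := hd w0 hw0
        rw [key w (ht' hw).1] at h1 ⊢
        rw [key w0 (ht' hw0).1] at h2
        apply hf
        rw [← (ht' hw).2, ← (ht' hw0).2, ← h1, ← h2]
    · refine ⟨q.out, fun w hw h => ?_⟩
      rw [key w hw.1, Quotient.out_eq, hw.2] at h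
      exact hq _ h.symm
  obtain ⟨d, hd⟩ := hex
  obtain ⟨w, hw, h1, h2, -⟩ := ht d (f (Quotient.mk _ d)).out
  refine hd w ⟨hw, ?_⟩ h1
  rw [key w hw] at h1 h2
  rw [← h2, ← h1, Quotient.out_eq]

lemma good_of (M : Model sig19) (s : Set M.W) (g : ℕ → M.D) (k : ℕ → M.D)
    (hr : Support M s g rho) (he : Support M s g (etaOf cA cB))
    (ht : ¬ Support M s g (thetaOf cA cB)) (hA : AxS (QP M s) (QN M s) (QE M s) k) :
    Good (QP M s) (QN M s) k (stSetoid M s) where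
  fin := finite_quot M s g hr he ht
  hPN x y u v h1 h2 := by
    rw [supp_theta] at ht
    exact ht ⟨x, y, fun w hw h3 h4 => h2 w hw h3 h4 (h1 w hw h3 h4)⟩
  hP t x y u v h1 h2 w hw h3 h4 := h2 w hw h3 ((M.eqEquiv w).trans (h1 w hw) h4)
  hP2 t z x y h1 h2 w hw h3 h4 := by
    refine (M.predCongr w () _ _ fun i => ?_).1 (h2 w hw h3 h4)
    simp only [ite_self]
    exact h1 w hw
  hA := hA

lemma num_sound (M : Model sig19) (s : Set M.W) (k : ℕ → M.D)
    (G : Good (QP M s) (QN M s) k (stSetoid M s)) (n : ℕ) (g : ℕ → M.D)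
    (hg : ∀ i ≤ 6, g i = k i) (h : Support M s g (numF n)) :
    rk (stSetoid M s) (QP M s) k (g 7) = n := by
  induction n generalizing g with
  | zero =>
    rw [numF, supp_eqF, hg 0 (by omega)] at h
    rw [rk_eq G h, rk_zero G]
  | succ n ih =>
    simp only [numF, Support, scF, supp_qp, supp_eqF] at h
    obtain ⟨d, h1, e, h2, h3⟩ := h
    have h4 := ih _ (fun i hi => by
      rw [Function.update_of_ne (by omega), Function.update_of_ne (by omega), hg i hi]) h3
    simp [hg 1 (by omega)] at h1 h2 h4
    rw [← rk_succ G h1, ← rk_eq G h2, h4]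

lemma phi_sound (C : PCode) (n : ℕ) (M : Model sig19) (s : Set M.W) (g : ℕ → M.D)
    (h : ¬ Support M s g (phi C.enc n)) : ∃ j, C.run (Nat.pair n j) = 0 := by
  rw [phi, Support] at h
  push Not at h
  obtain ⟨t, -, h, ht⟩ := h
  rw [Support, Support] at h
  obtain ⟨hr, he, hA⟩ := h
  simp only [AxF, Support] at hA
  obtain ⟨d0, d1, d2, d3, d4, d5, d6, hA, hgoal⟩ := hA
  generalize (Function.update _ 6 d6 : ℕ → M.D) = k at hA hgoal
  rw [supp_axs] at hA
  have G := good_of M t g k hr he ht hA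
  simp only [goalF, Support, prF, evF, supp_qp, supp_eqF] at hgoal
  obtain ⟨c, x, j, z, h1, h2, ⟨c', h3, h4⟩, ⟨x', h5, h6⟩⟩ := hgoal
  have h4 := num_sound M t k G _ _ (fun i hi => by
    simp only [Function.update_apply]; grind) h4
  have h6 := num_sound M t k G _ _ (fun i hi => by
    simp only [Function.update_apply]; grind) h6
  simp at h1 h2 h3 h4 h5 h6
  refine ⟨rk (stSetoid M t) (QP M t) k j, ?_⟩
  rw [← h6, rk_eq G h5, rk_pair G h1, ← rk_eval G C (by rw [← h4, rk_eq G h3]) h2, rk_zero G]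

/-! ### The finite countermodel -/

def finModel (N : ℕ) : Model sig19 where
  W := Fin (N + 1) × Fin (N + 1)
  D := Fin (N + 1)
  wNonempty := ⟨(0, 0)⟩
  dNonempty := ⟨0⟩
  predI := fun w _ as => QD N w.1 w.2 (as ⟨0, Nat.zero_lt_two⟩) (as ⟨1, Nat.one_lt_two⟩)
  funcI := fun w f _ => cond f w.2 w.1
  eqI := fun _ => Eq
  eqEquiv := fun _ => eq_equivalence
  predCongr := fun _ P as bs h => by
    have hab : as = bs := funext fun i => h i
    rw [hab]
  funcCongr := fun _ _ _ _ _ => rfl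

lemma finModel_QP (N : ℕ) : QP (finModel N) Set.univ = QD N := by
  funext x y u v
  apply propext
  constructor
  · intro h
    exact h (x, y) trivial rfl rfl
  · rintro h ⟨x', y'⟩ - h1 h2
    have h1 : x = x' := h1
    have h2 : y = y' := h2
    subst h1 h2
    exact h

lemma finModel_QN (N : ℕ) : QN (finModel N) Set.univ = fun t x y z => ¬ QD N t x y z := by
  funext x y u v
  apply propext
  constructor
  · intro h
    exact h (x, y) trivial rfl rfl
  · rintro h ⟨x', y'⟩ - h1 h2
    have h1 : x = x' := h1
    have h2 : y = y' := h2
    subst h1 h2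
    exact h

lemma finModel_QE (N : ℕ) : QE (finModel N) Set.univ = (Eq : Fin (N + 1) → Fin (N + 1) → Prop) := by
  funext x y
  apply propext
  constructor
  · intro h
    exact h (x, y) trivial
  · intro h w _
    exact h

lemma num_complete (M : Model sig19) (s : Set M.W) (k : ℕ → M.D) (val : M.D → ℕ)
    (hE : ∀ x y, val x = val y → QE M s x y)
    (h1 : ∀ x y z, val y = val x + 1 → QP M s (k 1) x y z)
    (hdown : ∀ x m, m ≤ val x → ∃ d, val d = m) (hk0 : val (k 0) = 0)
    (n : ℕ) (g : ℕ → M.D) (hg : ∀ i ≤ 6, g i = k i) (h : val (g 7) = n) :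
    Support M s g (numF n) := by
  induction n generalizing g with
  | zero =>
    rw [numF, supp_eqF, hg 0 (by omega)]
    exact hE _ _ (by rw [h, hk0])
  | succ n ih =>
    simp only [numF, Support, scF, supp_qp, supp_eqF]
    obtain ⟨d, hd⟩ := hdown (g 7) n (by omega)
    refine ⟨d, ?_, d, ?_, ?_⟩
    · simpa [hg 1 (by omega)] using h1 d (g 7) (g 7) (by omega)
    · exact hE _ _ (by simp)
    · refine ih _ (fun i hi => ?_) ?_
      · rw [Function.update_of_ne (by omega), Function.update_of_ne (by omega), hg i hi]
      · simpa using hd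

lemma axF_complete (M : Model sig19) (s : Set M.W) (k : ℕ → M.D) (val : M.D → ℕ)
    (hE : ∀ x y, val x = val y → QE M s x y)
    (h1 : ∀ x y z, val y = val x + 1 → QP M s (k 1) x y z)
    (hdown : ∀ x m, m ≤ val x → ∃ d, val d = m) (hk0 : val (k 0) = 0)
    (hA : AxS (QP M s) (QN M s) (QE M s) k)
    (c n : ℕ) (c' n' j' z' : M.D) (hc : val c' = c) (hn : val n' = n)
    (h2 : QP M s (k 2) n' j' z') (h3 : QP M s (k 3) c' z' (k 0)) :
    Support M s k (AxF c n) := by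
  simp only [AxF, Support]
  refine ⟨k 0, k 1, k 2, k 3, k 4, k 5, k 6, ?_⟩
  simp only [Function.update_eq_self]
  refine ⟨(supp_axs _ _ _).2 hA, ?_⟩
  simp only [goalF, Support, prF, evF, supp_qp, supp_eqF]
  refine ⟨c', n', j', z', ?_, ?_, ⟨c', ?_, ?_⟩, ⟨n', ?_, ?_⟩⟩
  · simpa using h2
  · simpa using h3
  · exact hE _ _ (by simp)
  · refine num_complete M s k val hE h1 hdown hk0 _ _ (fun i hi => ?_) (by simpa using hc)
    simp only [Function.update_apply]; grind
  · exact hE _ _ (by simp)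
  · refine num_complete M s k val hE h1 hdown hk0 _ _ (fun i hi => ?_) (by simpa using hn)
    simp only [Function.update_apply]; grind

lemma phi_complete (C : PCode) (n j : ℕ) (hj : C.run (Nat.pair n j) = 0) :
    ¬ IdValid (phi C.enc n) := by
  intro hv
  obtain ⟨N0, h0⟩ := Ev_exists C (Nat.pair n j)
  obtain ⟨N, hN6, hN0, hNc, hNp⟩ : ∃ N, 6 ≤ N ∧ N0 ≤ N ∧ C.enc ≤ N ∧ Nat.pair n j ≤ N :=
    ⟨max (max 6 N0) (max C.enc (Nat.pair n j)), by omega, by omega, by omega, by omega⟩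
  have h := hv (finModel N) (fun _ _ _ => Iff.rfl) Set.univ (kD N) Set.univ subset_rfl
  have hnt : ¬ Support (finModel N) Set.univ (kD N) (thetaOf cA cB) := by
    refine fun hh => ?_
    obtain ⟨d, e, h⟩ := (supp_theta (finModel N) _ _).1 hh
    exact h (d, e) trivial rfl rfl
  refine hnt (h ⟨?_, ?_, ?_⟩)
  · refine (supp_rho (finModel N) _ _).2 ?_
    intro x y
    by_cases hxy : x = y
    · exact Or.inl fun _ _ => hxy
    · exact Or.inr fun _ _ => hxy
  · refine (supp_eta (finModel N) _ _).2 ?_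
    rintro t - h1 h2 ⟨d, hd⟩
    by_contra hcon
    push Not at hcon
    choose F hFt hF using hcon
    have hinj : Function.Injective (fun x : Fin (N + 1) => atB (finModel N) (F x)) := by
      intro x y hxy
      obtain ⟨e, he⟩ := h2 {F x, F y} (by
        rintro w (rfl | rfl)
        · exact hFt x
        · exact hFt y) ⟨atB (finModel N) (F x), by
          rintro w (rfl | rfl)
          · rfl
          · exact hxy⟩
      have e1 : e = atA (finModel N) (F x) := he (F x) (Or.inl rfl)
      have e2 : e = atA (finModel N) (F y) := he (F y) (Or.inr rfl)
      have e3 : x = atA (finModel N) (F x) := hF x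
      have e4 : y = atA (finModel N) (F y) := hF y
      rw [e3, e4, ← e1, ← e2]
    obtain ⟨x, hx⟩ := Finite.surjective_of_injective hinj d
    exact hd (F x) (hFt x) hx.symm
  · have hn := Nat.left_le_pair n j
    have hj' := Nat.right_le_pair n j
    let c' : Fin (N + 1) := ⟨C.enc, by omega⟩
    let n' : Fin (N + 1) := ⟨n, by omega⟩
    let j' : Fin (N + 1) := ⟨j, by omega⟩
    let z' : Fin (N + 1) := ⟨Nat.pair n j, by omega⟩
    have hP : ∀ x y u v, QD N x y u v → QP (finModel N) Set.univ x y u v := by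
      intro x y u v h
      rw [finModel_QP]
      exact h
    refine axF_complete (finModel N) Set.univ (kD N) (fun x : Fin (N + 1) => x.1) ?_ ?_ ?_ ?_ ?_
      C.enc n c' n' j' z' rfl rfl ?_ ?_
    · intro x y h w _
      exact Fin.ext h
    · intro x y z h
      exact hP _ _ _ _ ((QD1 hN6 x y z).2 h.symm)
    · intro x m hm
      exact ⟨⟨m, lt_of_le_of_lt hm (Fin.is_lt x)⟩, rfl⟩
    · exact kD_val (by omega)
    · rw [finModel_QP, finModel_QN, finModel_QE]
      exact AxS_QD hN6
    · exact hP _ _ _ _ ((QD2 hN6 n' j' z').2 rfl)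
    · exact hP _ _ _ _ ((QD3 hN6 c' z' (kD N 0)).2
        (h0 N hN0 c' z' _ rfl rfl (by rw [kD_val (by omega), hj])))

/-! ### Computability -/

lemma fml_pair {f : ℕ → ℕ} (k : ℕ) (hf : Primrec f) : Primrec fun n => Nat.pair k (f n) :=
  Primrec₂.natPair.comp (Primrec.const k) hf

lemma code_numF : Primrec fun n => fmlCode (numF n) := by
  have h : Primrec (fun x : ℕ => fmlCode (numF 0)) := Primrec.const _
  have hs : Primrec fun x : ℕ => Nat.pair 7 (Nat.pair 8 (Nat.pair 3 (Nat.pair (fmlCode (scF 8 7))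
      (Nat.pair 7 (Nat.pair 7 (Nat.pair 3 (Nat.pair (fmlCode (eqF 7 8)) x))))))) :=
    fml_pair _ <| fml_pair _ <| fml_pair _ <| fml_pair _ <| fml_pair _ <| fml_pair _ <|
      fml_pair _ <| fml_pair _ Primrec.id
  refine (Primrec.nat_iterate Primrec.id h (hs.comp Primrec.snd).to₂).of_eq fun n => ?_
  induction n with
  | zero => rfl
  | succ n ih =>
    simp only [id] at ih ⊢
    rw [Function.iterate_succ_apply', ih]
    rfl

lemma code_conj {F G : ℕ → Formula sig19} (h1 : Primrec fun n => fmlCode (F n))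
    (h2 : Primrec fun n => fmlCode (G n)) : Primrec fun n => fmlCode (.conj (F n) (G n)) :=
  fml_pair 3 (Primrec₂.natPair.comp h1 h2)

lemma code_impl {F G : ℕ → Formula sig19} (h1 : Primrec fun n => fmlCode (F n))
    (h2 : Primrec fun n => fmlCode (G n)) : Primrec fun n => fmlCode (.impl (F n) (G n)) :=
  fml_pair 5 (Primrec₂.natPair.comp h1 h2)

lemma code_iex {F : ℕ → Formula sig19} (x : ℕ) (h1 : Primrec fun n => fmlCode (F n)) :
    Primrec fun n => fmlCode (.iex x (F n)) :=
  fml_pair 7 (fml_pair x h1)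

lemma code_const (A : Formula sig19) : Primrec fun _ : ℕ => fmlCode A := Primrec.const _

lemma code_goal (c : ℕ) : Primrec fun n => fmlCode (goalF c n) := by
  unfold goalF
  exact code_iex _ <| code_iex _ <| code_iex _ <| code_iex _ <|
    code_conj (code_const _) <| code_conj (code_const _) <| code_conj (code_const _) <|
      code_iex _ <| code_conj (code_const _) code_numF

lemma code_phi (c : ℕ) : Primrec fun n => fmlCode (phi c n) := by
  unfold phi AxF
  refine code_impl (code_conj (code_const _) (code_conj (code_const _) ?_)) (code_const _)
  exact code_iex _ <| code_iex _ <| code_iex _ <| code_iex _ <| code_iex _ <| code_iex _ <|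
    code_iex _ <| code_conj (code_const _) (code_goal c)

lemma exists_pcode : ∃ C : PCode, ∀ c : Nat.Partrec.Code,
    (c.eval 0).Dom ↔ ∃ j, C.run (Nat.pair (Encodable.encode c) j) = 0 := by
  let F : ℕ → ℕ → ℕ := fun n k =>
    if (Nat.Partrec.Code.evaln k (Denumerable.ofNat Nat.Partrec.Code n) 0).isSome then 0 else 1
  have hF : Primrec₂ F := by
    have h1 : Primrec fun p : ℕ × ℕ =>
        Nat.Partrec.Code.evaln p.2 (Denumerable.ofNat Nat.Partrec.Code p.1) 0 :=
      Nat.Partrec.Code.primrec_evaln.comp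
        ((Primrec.snd.pair ((Primrec.ofNat Nat.Partrec.Code).comp Primrec.fst)).pair
          (Primrec.const 0))
    have h2 := Primrec.option_isSome.comp h1
    exact (Primrec.ite (Primrec.eq.comp h2 (Primrec.const true)) (Primrec.const 0)
      (Primrec.const 1))
  obtain ⟨C, hC⟩ := PCode.exists_code (Primrec₂.unpaired'.2 hF)
  refine ⟨C, fun c => ?_⟩
  simp only [hC, Nat.unpaired, Nat.unpair_pair, F, Denumerable.ofNat_encode]
  rw [Part.dom_iff_mem]
  simp only [Nat.Partrec.Code.evaln_complete]
  rw [exists_comm]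
  refine exists_congr fun k => ?_
  cases h : Nat.Partrec.Code.evaln k c 0 <;> simp

/-- Generic reduction. -/
lemma not_re_of (ν : EffectiveNumbering) (V : Formula sig19 → Prop)
    (h1 : ∀ φ, Valid φ → V φ) (h2 : ∀ φ, V φ → IdValid φ) :
    ¬ REset {n | ∃ φ : Formula sig19, φ.IsSentence ∧ V φ ∧ ν.nu φ = n} := by
  rintro ⟨f, hf, hfS⟩
  obtain ⟨G, hG, hGν⟩ := ν.ofStd
  obtain ⟨C, hC⟩ := exists_pcode
  apply ComputablePred.halting_problem_not_re 0
  have hp : Partrec fun c : Nat.Partrec.Code =>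
      (G (fmlCode (phi C.enc (Encodable.encode c)))).bind f := by
    have a1 : Partrec fun c : Nat.Partrec.Code =>
        G (fmlCode (phi C.enc (Encodable.encode c))) :=
      (Partrec.nat_iff.2 hG).comp ((code_phi C.enc).comp Primrec.encode).to_comp
    exact a1.bind ((Partrec.nat_iff.2 hf).comp Computable.snd).to₂
  refine (Partrec.dom_re hp).of_eq fun c => ?_
  rw [hGν, show (Part.some (ν.nu (phi C.enc (Encodable.encode c)))).bind f = f _ from
    Part.bind_some _ _, ← hfS]
  rw [hC]
  constructor
  · rintro ⟨φ, -, hV, hφ⟩ ⟨j, hj⟩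
    rw [ν.inj hφ] at hV
    exact phi_complete C _ j hj (h2 _ hV)
  · intro hn
    refine ⟨_, phi_sentence _ _, h1 _ fun M s g => ?_, rfl⟩
    by_contra hcon
    exact hn (phi_sound C _ M s g hcon)


/-- Under any effective Gödel numbering of InqBQ sentences over a
signature with a binary predicate and the constants a, b, neither the set of codes of
id-valid sentences nor the set of codes of valid sentences is recursively enumerable. -/
theorem validities_not_re (ν : EffectiveNumbering) :
    ¬ REset {n | ∃ φ : Formula sig19, φ.IsSentence ∧ IdValid φ ∧ ν.nu φ = n} ∧
    ¬ REset {n | ∃ φ : Formula sig19, φ.IsSentence ∧ Valid φ ∧ ν.nu φ = n} := by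
  exact ⟨not_re_of ν IdValid (fun φ h M _ s g => h M s g) (fun _ h => h),
    not_re_of ν Valid (fun _ h => h) (fun φ h M _ s g => h M s g)⟩

end InqBQ
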